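/- The Waldschmidt constant of 𝔭 equals its initial degree: γ(𝔭) = lim_{n→∞} α(𝔭^{(n)})/n = 2 = α(𝔭); in fact α(𝔭^{(2n)}) = 4n and α(𝔭^{(2n+1)}) = 4n+2 for all n ≥ 0. -/

import Mathlib

open MvPolynomial

noncomputable def curveMap (k : Type*) [Field k] (q m : ℕ) :
    MvPolynomial (Fin 4) k →ₐ[k] MvPolynomial (Fin 2) k :=
  aeval ![X 0 ^ (2*q+1+2*m), X 0 ^ (2*q+1+m) * X 1 ^ m, X 0 ^ (2*q+1) * X 1 ^ (2*m),
    X 1 ^ (2*q+1+2*m)]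

noncomputable def curveIdeal (k : Type*) [Field k] (q m : ℕ) : Ideal (MvPolynomial (Fin 4) k) :=
  RingHom.ker (curveMap k q m)

instance (k : Type*) [Field k] (q m : ℕ) : (curveIdeal k q m).IsPrime :=
  RingHom.ker_isPrime _

noncomputable def symbPow (k : Type*) [Field k] (q m n : ℕ) :
    Ideal (MvPolynomial (Fin 4) k) :=
  (Ideal.map (algebraMap _ (Localization.AtPrime (curveIdeal k q m)))
      ((curveIdeal k q m) ^ n)).comap
    (algebraMap _ (Localization.AtPrime (curveIdeal k q m)))

noncomputable def fPoly (k : Type*) [Field k] (q m : ℕ) : MvPolynomial (Fin 4) k :=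
  - X 2 ^ (2*(q+m)+1) - X 0 ^ (q-1) * X 1 ^ 3 * X 2 ^ (q+m-1) * X 3 ^ m
    + 3 * X 0 ^ q * X 1 * X 2 ^ (q+m) * X 3 ^ m - X 0 ^ (2*q+1) * X 3 ^ (2*m)

noncomputable def moduleLength (R M : Type*) [Ring R] [AddCommGroup M] [Module R M] :
    WithBot ℕ∞ :=
  Order.krullDim (Submodule R M)

/-- `α(I)`: the least degree of a nonzero homogeneous element of `I`. -/
noncomputable def alphaDeg {k : Type*} [Field k] (I : Ideal (MvPolynomial (Fin 4) k)) : ℕ :=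
  sInf {d : ℕ | ∃ g ∈ I, g ≠ 0 ∧ MvPolynomial.IsHomogeneous g d}

namespace S18

/-- linear map sending each monomial `X^a` to `X^(h a)` -/
noncomputable def lin (k : Type*) [Field k] {σ τ : Type*} (h : (σ →₀ ℕ) → (τ →₀ ℕ)) :
    MvPolynomial σ k →ₗ[k] MvPolynomial τ k :=
  (basisMonomials σ k).constr k (fun a => monomial (h a) (1 : k))

variable {k : Type*} [Field k] {σ τ υ : Type*}

lemma lin_monomial (h : (σ →₀ ℕ) → (τ →₀ ℕ)) (a : σ →₀ ℕ) (c : k) :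
    lin k h (monomial a c) = monomial (h a) c := by
  have h1 : (monomial a c : MvPolynomial σ k) = c • basisMonomials σ k a := by
    simp [smul_monomial]
  rw [h1, map_smul, lin, Module.Basis.constr_basis, smul_monomial]
  simp

lemma lin_comp (h : (σ →₀ ℕ) → (τ →₀ ℕ)) (h' : (τ →₀ ℕ) → (υ →₀ ℕ)) (g : MvPolynomial σ k) :
    lin k h' (lin k h g) = lin k (h' ∘ h) g := by
  induction g using MvPolynomial.induction_on' with
  | monomial a c => simp [lin_monomial]
  | add p q hp hq => simp [map_add, hp, hq]

lemma lin_zero_of_factor [Nonempty (υ →₀ ℕ)] (h : (σ →₀ ℕ) → (τ →₀ ℕ))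
    (h' : (σ →₀ ℕ) → (υ →₀ ℕ))
    (H : ∀ a b, h a = h b → h' a = h' b) (g : MvPolynomial σ k) (hg : lin k h g = 0) :
    lin k h' g = 0 := by
  have hf : Function.FactorsThrough h' h := fun a b hab => H a b hab
  have : h' = (Function.extend h h' (fun _ => 0)) ∘ h := by
    funext a
    exact (hf.extend_apply _ a).symm
  rw [this, ← lin_comp, hg, map_zero]

lemma dvd_of_lin (h : (σ →₀ ℕ) → (τ →₀ ℕ)) (red : (σ →₀ ℕ) → (σ →₀ ℕ)) (F : MvPolynomial σ k)
    (hred : ∀ a, F ∣ monomial a (1 : k) - monomial (red a) 1)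
    (H : ∀ a b, h a = h b → red a = red b) (g : MvPolynomial σ k) (hg : lin k h g = 0) :
    F ∣ g := by
  have h0 := lin_zero_of_factor h red H g hg
  have h1 : F ∣ g - lin k red g := by
    clear h0 hg
    induction g using MvPolynomial.induction_on' with
    | monomial a c =>
      rw [lin_monomial]
      have := (hred a).mul_left (C c)
      simpa [mul_sub, C_mul_monomial] using this
    | add p q hp hq =>
      rw [map_add, add_sub_add_comm]
      exact dvd_add hp hq
  simpa [h0] using h1

lemma aeval_eq_lin (v : σ → MvPolynomial τ k) (h : (σ →₀ ℕ) → (τ →₀ ℕ))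
    (H : ∀ a, aeval v (monomial a (1 : k)) = monomial (h a) 1) (g : MvPolynomial σ k) :
    aeval v g = lin k h g := by
  induction g using MvPolynomial.induction_on' with
  | monomial a c =>
    have : (monomial a c : MvPolynomial σ k) = c • monomial a 1 := by simp [smul_monomial]
    rw [this, map_smul, H, map_smul, lin_monomial]
  | add p q hp hq => simp only [map_add, hp, hq]

/-- exponent vectors -/
noncomputable def ev {n : ℕ} (v : Fin n → ℕ) : Fin n →₀ ℕ := Finsupp.equivFunOnFinite.symm v

lemma ev_inj {n : ℕ} {v w : Fin n → ℕ} : ev v = ev w ↔ v = w :=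
  Finsupp.equivFunOnFinite.symm.injective.eq_iff

lemma mon4 (a : Fin 4 →₀ ℕ) : (monomial a (1 : k)) =
    X 0 ^ a 0 * X 1 ^ a 1 * X 2 ^ a 2 * X 3 ^ a 3 := by
  rw [monomial_eq, Finsupp.prod_fintype _ _ (by simp)]
  simp [Fin.prod_univ_four]

lemma mon3 (a : Fin 3 →₀ ℕ) : (monomial a (1 : k)) =
    X 0 ^ a 0 * X 1 ^ a 1 * X 2 ^ a 2 := by
  rw [monomial_eq, Finsupp.prod_fintype _ _ (by simp)]
  simp [Fin.prod_univ_three]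

lemma mon2 (a : Fin 2 →₀ ℕ) : (monomial a (1 : k)) = X 0 ^ a 0 * X 1 ^ a 1 := by
  rw [monomial_eq, Finsupp.prod_fintype _ _ (by simp)]
  simp [Fin.prod_univ_two]

/-- the map `X0 ↦ s, X1 ↦ st, X2 ↦ st², X3 ↦ su`, with `s,t,u = X 0, X 1, X 2`. -/
noncomputable def psi (k : Type*) [Field k] : MvPolynomial (Fin 4) k →ₐ[k] MvPolynomial (Fin 3) k :=
  aeval ![X 0, X 0 * X 1, X 0 * X 1 ^ 2, X 0 * X 2]

/-- the map `s ↦ s, t ↦ z^m, u ↦ z^N`. -/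
noncomputable def pi' (k : Type*) [Field k] (m N : ℕ) :
    MvPolynomial (Fin 3) k →ₐ[k] MvPolynomial (Fin 2) k :=
  aeval ![X 0, X 1 ^ m, X 1 ^ N]

noncomputable def Lpsi (a : Fin 4 →₀ ℕ) : Fin 3 →₀ ℕ :=
  ev ![a 0 + a 1 + a 2 + a 3, a 1 + 2 * a 2, a 3]

noncomputable def Lpi (m N : ℕ) (a : Fin 3 →₀ ℕ) : Fin 2 →₀ ℕ :=
  ev ![a 0, m * a 1 + N * a 2]

noncomputable def Lphi (q m : ℕ) (a : Fin 4 →₀ ℕ) : Fin 2 →₀ ℕ :=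
  ev ![(2*q+1+2*m) * a 0 + (2*q+1+m) * a 1 + (2*q+1) * a 2,
    m * a 1 + 2 * m * a 2 + (2*q+1+2*m) * a 3]

lemma psi_eq (g : MvPolynomial (Fin 4) k) : psi k g = lin k Lpsi g := by
  apply aeval_eq_lin
  intro a
  rw [mon4, mon3]
  simp [Lpsi, ev]
  ring

lemma pi_eq (m N : ℕ) (g : MvPolynomial (Fin 3) k) : pi' k m N g = lin k (Lpi m N) g := by
  apply aeval_eq_lin
  intro a
  rw [mon3, mon2]
  simp [Lpi, ev]
  ring

lemma phi_eq (q m : ℕ) (g : MvPolynomial (Fin 4) k) : curveMap k q m g = lin k (Lphi q m) g := by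
  apply aeval_eq_lin
  intro a
  rw [mon4, mon2]
  simp [Lphi, ev]
  ring

noncomputable def f (k : Type*) [Field k] : MvPolynomial (Fin 4) k := X 1 ^ 2 - X 0 * X 2
noncomputable def G (k : Type*) [Field k] (q m : ℕ) : MvPolynomial (Fin 4) k :=
  X 1 * X 2 ^ (q+m) - X 0 ^ (q+1) * X 3 ^ m
noncomputable def F (k : Type*) [Field k] (q m : ℕ) : MvPolynomial (Fin 3) k :=
  X 1 ^ (2*q+1+2*m) - X 2 ^ m

lemma psi_f : psi k (f k) = 0 := by
  simp [psi, f]; ring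

lemma psi_G (q m : ℕ) : psi k (G k q m) = X 0 ^ (q+m+1) * F k q m := by
  simp [psi, G, F]; ring

lemma psi_X0 : psi k (X 0) = X 0 := by simp [psi]

lemma f_dvd (g : MvPolynomial (Fin 4) k) (hg : psi k g = 0) : f k ∣ g := by
  rw [psi_eq] at hg
  refine dvd_of_lin Lpsi (fun a => ev ![a 0 + a 1 / 2, a 1 % 2, a 2 + a 1 / 2, a 3]) _ ?_ ?_ g hg
  · intro a
    rw [mon4, mon4]
    have h1 : f k ∣ (X 1 ^ 2) ^ (a 1 / 2) - (X 0 * X 2) ^ (a 1 / 2) := sub_dvd_pow_sub_pow _ _ _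
    have h2 := h1.mul_left (X 0 ^ a 0 * X 1 ^ (a 1 % 2) * X 2 ^ a 2 * X 3 ^ a 3)
    convert h2 using 1
    conv_lhs => enter [1, 1, 1, 2]; rw [← Nat.div_add_mod (a 1) 2]
    simp [ev]
    ring
  · intro a b hab
    simp only [Lpsi, ev_inj, Matrix.vecCons_inj] at hab ⊢
    refine ⟨?_, ?_, ?_, ?_, trivial⟩ <;> omega

lemma F_dvd (q m : ℕ) (hco : Nat.Coprime (2*q+1) m) (g : MvPolynomial (Fin 3) k)
    (hg : pi' k m (2*q+1+2*m) g = 0) : F k q m ∣ g := by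
  rw [pi_eq] at hg
  set N := 2*q+1+2*m with hN
  have hNpos : 0 < N := by omega
  have hcop : Nat.Coprime N m := by
    rw [hN]; simpa using hco
  refine dvd_of_lin (Lpi m N) (fun a => ev ![a 0, a 1 % N, a 2 + m * (a 1 / N)]) _ ?_ ?_ g hg
  · intro a
    rw [mon3, mon3]
    have h1 : F k q m ∣ (X 1 ^ N) ^ (a 1 / N) - (X 2 ^ m) ^ (a 1 / N) := sub_dvd_pow_sub_pow _ _ _
    have h2 := h1.mul_left (X 0 ^ a 0 * X 1 ^ (a 1 % N) * X 2 ^ a 2)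
    convert h2 using 1
    conv_lhs => enter [1, 1, 2]; rw [← Nat.div_add_mod (a 1) N]
    simp [ev]
    ring
  · intro a b hab
    simp only [Lpi, ev_inj, Matrix.vecCons_inj] at hab ⊢
    obtain ⟨h0, h1, -⟩ := hab
    have hmod : a 1 % N = b 1 % N := by
      have : m * a 1 ≡ m * b 1 [MOD N] := by
        have h2 : (m * a 1 + N * a 2) % N = (m * b 1 + N * b 2) % N := by rw [h1]
        simpa [Nat.ModEq] using h2
      exact Nat.ModEq.cancel_left_of_coprime hcop this
    refine ⟨h0, hmod, ?_, trivial⟩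
    have ea := Nat.div_add_mod (a 1) N
    have eb := Nat.div_add_mod (b 1) N
    rw [← ea, ← eb, hmod] at h1
    have : N * (a 2 + m * (a 1 / N)) = N * (b 2 + m * (b 1 / N)) := by
      nlinarith
    exact Nat.eq_of_mul_eq_mul_left hNpos this

lemma pi_F (q m : ℕ) : pi' k m (2*q+1+2*m) (F k q m) = 0 := by
  simp [pi', F]; ring

lemma mem_p_iff (q m : ℕ) (g : MvPolynomial (Fin 4) k) :
    g ∈ curveIdeal k q m ↔ pi' k m (2*q+1+2*m) (psi k g) = 0 := by
  rw [curveIdeal, RingHom.mem_ker, phi_eq, psi_eq, pi_eq, lin_comp]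
  constructor
  · apply lin_zero_of_factor
    intro a b hab
    simp only [Lphi, Lpi, Lpsi, ev, Function.comp, Finsupp.equivFunOnFinite_symm_apply_apply] at hab ⊢
    have h0 := congrFun (Finsupp.equivFunOnFinite.symm.injective hab) 0
    have h1 := congrFun (Finsupp.equivFunOnFinite.symm.injective hab) 1
    simp at h0 h1
    congr 1
    funext i
    fin_cases i
    · simp
      have : (2*q+1+2*m) * (a 0 + a 1 + a 2 + a 3) = (2*q+1+2*m) * (b 0 + b 1 + b 2 + b 3) := by
        nlinarith
      exact Nat.eq_of_mul_eq_mul_left (by omega) this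
    · simp
      nlinarith
  · apply lin_zero_of_factor
    intro a b hab
    simp only [Lphi, Lpi, Lpsi, ev, Function.comp] at hab ⊢
    have h0 := congrFun (Finsupp.equivFunOnFinite.symm.injective hab) 0
    have h1 := congrFun (Finsupp.equivFunOnFinite.symm.injective hab) 1
    simp at h0 h1
    congr 1
    funext i
    have h2 : (2*q+1+2*m) * (a 0 + a 1 + a 2 + a 3) = (2*q+1+2*m) * (b 0 + b 1 + b 2 + b 3) := by
      rw [h0]
    fin_cases i
    · simp
      nlinarith
    · simp
      nlinarith

lemma mem_p_iff' (q m : ℕ) (hco : Nat.Coprime (2*q+1) m) (g : MvPolynomial (Fin 4) k) :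
    g ∈ curveIdeal k q m ↔ F k q m ∣ psi k g := by
  rw [mem_p_iff]
  constructor
  · exact F_dvd q m hco _
  · rintro ⟨h, e⟩
    rw [e, map_mul, pi_F, zero_mul]

lemma F_coeff (q m : ℕ) (hm : 1 ≤ m) :
    coeff (Finsupp.single 1 (2*q+1+2*m)) (F k q m) = 1 := by
  rw [F, coeff_sub, coeff_X_pow, coeff_X_pow]
  rw [if_pos rfl, if_neg, sub_zero]
  intro h
  have := DFunLike.congr_fun h 1
  simp at this
  omega

lemma F_ne (q m : ℕ) (hm : 1 ≤ m) : F k q m ≠ 0 := by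
  intro h
  have := F_coeff (k := k) q m hm
  simp [h] at this

lemma F_prime (q m : ℕ) (hm : 1 ≤ m) (hco : Nat.Coprime (2*q+1) m) : Prime (F k q m) := by
  refine ⟨F_ne q m hm, ?_, ?_⟩
  · intro hu
    have := hu.map (pi' k m (2*q+1+2*m))
    rw [pi_F] at this
    exact not_isUnit_zero this
  · intro a b hab
    have h : pi' k m (2*q+1+2*m) (a * b) = 0 := by
      obtain ⟨c, hc⟩ := hab
      rw [hc, map_mul, pi_F, zero_mul]
    rw [map_mul, mul_eq_zero] at h
    exact h.imp (F_dvd q m hco _) (F_dvd q m hco _)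

lemma f_coeff : coeff (Finsupp.single 1 2) (f k) = 1 := by
  have h : (X 0 * X 2 : MvPolynomial (Fin 4) k) =
      monomial (Finsupp.single 0 1 + Finsupp.single 2 1) 1 := by
    simp [X, monomial_mul]
  rw [f, coeff_sub, coeff_X_pow, h, coeff_monomial, if_pos rfl, if_neg, sub_zero]
  intro h
  have := DFunLike.congr_fun h 1
  simp at this

lemma f_ne : f k ≠ 0 := by
  intro h
  have := f_coeff (k := k)
  simp [h] at this

lemma f_hom : (f k).IsHomogeneous 2 := by
  have h1 : (X 1 ^ 2 : MvPolynomial (Fin 4) k).IsHomogeneous 2 := by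
    simpa using (isHomogeneous_X k (1 : Fin 4)).pow 2
  have h2 : (X 0 * X 2 : MvPolynomial (Fin 4) k).IsHomogeneous 2 := by
    simpa using (isHomogeneous_X k (0 : Fin 4)).mul (isHomogeneous_X k (2 : Fin 4))
  exact h1.sub h2

lemma f_mem (q m : ℕ) : f k ∈ curveIdeal k q m := by
  rw [mem_p_iff, psi_f, map_zero]

lemma f_prime_dvd {a b : MvPolynomial (Fin 4) k} (hab : f k ∣ a * b) (ha : psi k a ≠ 0) :
    f k ∣ b := by
  obtain ⟨c, hc⟩ := hab
  have : psi k a * psi k b = 0 := by rw [← map_mul, hc, map_mul, psi_f, zero_mul]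
  exact f_dvd _ ((mul_eq_zero.mp this).resolve_left ha)

lemma exists_lift (H : MvPolynomial (Fin 3) k) : ∃ (j : ℕ) (K : MvPolynomial (Fin 4) k),
    psi k K = X 0 ^ j * H := by
  induction H using MvPolynomial.induction_on' with
  | monomial a c =>
    refine ⟨a 1 + a 2, C c * (X 0 ^ a 0 * X 1 ^ a 1 * X 3 ^ a 2), ?_⟩
    have : (monomial a c : MvPolynomial (Fin 3) k) = C c * monomial a 1 := by
      simp [C_mul_monomial]
    rw [this, mon3]
    simp [psi]
    ring
  | add p q hp hq =>
    obtain ⟨j1, K1, h1⟩ := hp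
    obtain ⟨j2, K2, h2⟩ := hq
    refine ⟨j1 + j2, X 0 ^ j2 * K1 + X 0 ^ j1 * K2, ?_⟩
    simp only [map_add, map_mul, map_pow, psi_X0, h1, h2]
    ring

/-- the local complete intersection ideal -/
noncomputable def I (k : Type*) [Field k] (q m : ℕ) : Ideal (MvPolynomial (Fin 4) k) :=
  Ideal.span {f k} ⊔ Ideal.span {G k q m}

lemma p_to_I (q m : ℕ) (hco : Nat.Coprime (2*q+1) m) (g : MvPolynomial (Fin 4) k)
    (hg : g ∈ curveIdeal k q m) : ∃ j : ℕ, X 0 ^ j * g ∈ I k q m := by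
  rw [mem_p_iff' q m hco] at hg
  obtain ⟨H, hH⟩ := hg
  obtain ⟨j, K, hK⟩ := exists_lift H
  refine ⟨q + m + 1 + j, ?_⟩
  have h0 : psi k (X 0 ^ (q+m+1+j) * g - G k q m * K) = 0 := by
    simp only [map_sub, map_mul, map_pow, psi_X0, psi_G, hH, hK]
    ring
  have h1 := Ideal.mem_span_singleton.mpr (f_dvd _ h0)
  have h2 : G k q m * K ∈ Ideal.span {G k q m} :=
    Ideal.mul_mem_right _ _ (Ideal.mem_span_singleton_self _)
  have := (I k q m).add_mem (Ideal.mem_sup_left h1) (Ideal.mem_sup_right h2)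
  simpa using this

lemma pn_to_I (q m : ℕ) (hco : Nat.Coprime (2*q+1) m) (n : ℕ) (g : MvPolynomial (Fin 4) k)
    (hg : g ∈ curveIdeal k q m ^ n) : ∃ j : ℕ, X 0 ^ j * g ∈ I k q m ^ n := by
  induction n generalizing g with
  | zero => exact ⟨0, by simp⟩
  | succ n ih =>
    rw [pow_succ] at hg
    induction hg using Submodule.mul_induction_on' with
    | mem_mul_mem a ha b hb =>
      obtain ⟨i, hi⟩ := ih a ha
      obtain ⟨j, hj⟩ := p_to_I q m hco b hb
      refine ⟨i + j, ?_⟩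
      rw [pow_succ]
      have := Ideal.mul_mem_mul hi hj
      convert this using 1
      ring
    | add a _ b _ ha hb =>
      obtain ⟨i, hi⟩ := ha
      obtain ⟨j, hj⟩ := hb
      refine ⟨i + j, ?_⟩
      have h1 := Ideal.mul_mem_left _ (X 0 ^ j) hi
      have h2 := Ideal.mul_mem_left _ (X 0 ^ i) hj
      convert Ideal.add_mem _ h1 h2 using 1
      ring

lemma I_pow (q m n : ℕ) :
    I k q m ^ (n+1) ≤ Ideal.span {f k} * I k q m ^ n ⊔ Ideal.span {G k q m ^ (n+1)} := by
  induction n with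
  | zero => simp [I]
  | succ n ih =>
    have e : I k q m ^ (n+1+1) =
        Ideal.span {f k} * I k q m ^ (n+1) ⊔ Ideal.span {G k q m} * I k q m ^ (n+1) := by
      rw [pow_succ' _ (n+1), ← Ideal.sup_mul]; rfl
    rw [e]
    refine sup_le le_sup_left ?_
    refine (Ideal.mul_mono_right ih).trans ?_
    rw [Ideal.mul_sup]
    refine sup_le_sup ?_ ?_
    · rw [mul_left_comm, pow_succ']
      exact Ideal.mul_mono_right (Ideal.mul_mono_left le_sup_right)
    · rw [Ideal.span_singleton_mul_span_singleton, ← pow_succ']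

lemma I_pow_psi (q m n : ℕ) (g : MvPolynomial (Fin 4) k) (hg : g ∈ I k q m ^ n) :
    F k q m ^ n ∣ psi k g := by
  have h1 : Ideal.map (psi k) (I k q m) ≤ Ideal.span {F k q m} := by
    rw [I, Ideal.map_sup, Ideal.map_span, Ideal.map_span]
    simp only [Set.image_singleton, psi_f, psi_G]
    refine sup_le (by simp) ?_
    rw [Ideal.span_singleton_le_span_singleton]
    exact dvd_mul_left _ _
  have h2 := Ideal.mem_map_of_mem (psi k) hg
  rw [Ideal.map_pow] at h2
  have h3 := Ideal.pow_right_mono h1 n h2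
  rwa [Ideal.span_singleton_pow, Ideal.mem_span_singleton] at h3

lemma deg_psi (g : MvPolynomial (Fin 4) k) :
    degreeOf 1 (psi k g) ≤ 2 * g.totalDegree := by
  rw [g.as_sum, map_sum, ← g.as_sum]
  refine (degreeOf_sum_le _ _ _).trans ?_
  refine Finset.sup_le fun a ha => ?_
  rw [psi_eq, lin_monomial]
  have hc : coeff a g ≠ 0 := mem_support_iff.mp ha
  rw [degreeOf_monomial_eq _ _ hc]
  have h := le_totalDegree ha
  rw [Finsupp.sum_fintype _ _ (by simp), Fin.sum_univ_four] at h
  simp [Lpsi, ev]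
  omega

lemma main (q m : ℕ) (hq : 1 ≤ q) (hm : 1 ≤ m) (hco : Nat.Coprime (2*q+1) m) (n : ℕ)
    (g w : MvPolynomial (Fin 4) k) (hg0 : g ≠ 0) (hw : w ∉ curveIdeal k q m)
    (h : w * g ∈ I k q m ^ n) : 2 * n ≤ g.totalDegree := by
  induction n generalizing g with
  | zero => simp
  | succ n ih =>
    by_cases hz : psi k g = 0
    · obtain ⟨g', rfl⟩ := f_dvd g hz
      have hg' : g' ≠ 0 := right_ne_zero_of_mul hg0
      have h1 := I_pow q m n h
      rw [Submodule.mem_sup] at h1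
      obtain ⟨y, hy, z, hz, e⟩ := h1
      rw [Ideal.mem_span_singleton_mul] at hy
      obtain ⟨y', hy', rfl⟩ := hy
      rw [Ideal.mem_span_singleton] at hz
      obtain ⟨b, rfl⟩ := hz
      have hb : f k ∣ b := by
        apply f_prime_dvd (a := G k q m ^ (n+1))
        · refine ⟨w * g' - y', ?_⟩
          linear_combination e
        · rw [map_pow, psi_G]
          exact pow_ne_zero _ (mul_ne_zero (pow_ne_zero _ (X_ne_zero _)) (F_ne q m hm))
      obtain ⟨b', rfl⟩ := hb
      have e2 : w * g' = y' + G k q m ^ (n+1) * b' := by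
        apply mul_left_cancel₀ (f_ne (k := k))
        linear_combination -e
      have hmem : w * g' ∈ I k q m ^ n := by
        rw [e2]
        refine Ideal.add_mem _ hy' (Ideal.mul_mem_right _ _ ?_)
        have hG : G k q m ∈ I k q m := Ideal.mem_sup_right (Ideal.mem_span_singleton_self _)
        exact Ideal.pow_le_pow_right (Nat.le_succ n) (Ideal.pow_mem_pow hG _)
      have := ih g' hg' hmem
      rw [totalDegree_mul_of_isDomain f_ne hg', f_hom.totalDegree f_ne]
      omega
    · have h1 := I_pow_psi q m _ _ h
      rw [map_mul] at h1
      have h2 : F k q m ^ (n+1) ∣ psi k g := by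
        refine (F_prime q m hm hco).pow_dvd_of_dvd_mul_left _ ?_ h1
        rwa [← mem_p_iff' q m hco]
      obtain ⟨c, hc⟩ := h2
      have hc0 : c ≠ 0 := by
        rintro rfl
        exact hz (by rw [hc, mul_zero])
      have h3 : degreeOf 1 (psi k g) = (n+1) * degreeOf 1 (F k q m) + degreeOf 1 c := by
        rw [hc, degreeOf_mul_eq (pow_ne_zero _ (F_ne q m hm)) hc0, degreeOf_pow_eq _ _ _ (F_ne q m hm)]
      have h4 : 2*q+1+2*m ≤ degreeOf 1 (F k q m) := by
        have : Finsupp.single 1 (2*q+1+2*m) ∈ (F k q m).support := by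
          rw [mem_support_iff, F_coeff q m hm]; exact one_ne_zero
        simpa using monomial_le_degreeOf 1 this
      have h5 := deg_psi g
      have h6 : (n+1) * 4 ≤ (n+1) * degreeOf 1 (F k q m) := Nat.mul_le_mul_left _ (by omega)
      omega

lemma lower (q m : ℕ) (hq : 1 ≤ q) (hm : 1 ≤ m) (hco : Nat.Coprime (2*q+1) m) (n : ℕ)
    (g : MvPolynomial (Fin 4) k) (hg0 : g ≠ 0) (hg : g ∈ symbPow k q m n) :
    2 * n ≤ g.totalDegree := by
  rw [symbPow, Ideal.mem_comap,
    IsLocalization.algebraMap_mem_map_algebraMap_iff (curveIdeal k q m).primeCompl] at hg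
  obtain ⟨w, hw, hwg⟩ := hg
  obtain ⟨j, hj⟩ := pn_to_I q m hco n _ hwg
  rw [← mul_assoc] at hj
  refine main q m hq hm hco n g _ hg0 ?_ hj
  intro hmem
  rcases (inferInstance : (curveIdeal k q m).IsPrime).mem_or_mem hmem with h | h
  · have := (inferInstance : (curveIdeal k q m).IsPrime).mem_of_pow_mem _ h
    rw [mem_p_iff, psi_X0] at this
    simp [pi'] at this
  · exact hw h

lemma alpha (q m : ℕ) (hq : 1 ≤ q) (hm : 1 ≤ m) (hco : Nat.Coprime (2*q+1) m) (n : ℕ) :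
    alphaDeg (symbPow k q m n) = 2 * n := by
  have hmem : 2 * n ∈ {d : ℕ | ∃ g ∈ symbPow k q m n, g ≠ 0 ∧ MvPolynomial.IsHomogeneous g d} := by
    refine ⟨f k ^ n, ?_, pow_ne_zero _ f_ne, f_hom.pow n⟩
    exact Ideal.le_comap_map (Ideal.pow_mem_pow (f_mem q m) n)
  apply le_antisymm (Nat.sInf_le hmem)
  apply le_csInf ⟨_, hmem⟩
  rintro d ⟨g, hg, hg0, hd⟩
  rw [← hd.totalDegree hg0]
  exact lower q m hq hm hco n g hg0 hg

lemma alpha_p (q m : ℕ) (hq : 1 ≤ q) (hm : 1 ≤ m) (hco : Nat.Coprime (2*q+1) m) :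
    alphaDeg (curveIdeal k q m) = 2 := by
  have hmem : 2 ∈ {d : ℕ | ∃ g ∈ curveIdeal k q m, g ≠ 0 ∧ MvPolynomial.IsHomogeneous g d} :=
    ⟨f k, f_mem q m, f_ne, f_hom⟩
  apply le_antisymm (Nat.sInf_le hmem)
  apply le_csInf ⟨_, hmem⟩
  rintro d ⟨g, hg, hg0, hd⟩
  rw [← hd.totalDegree hg0]
  have hg' : g ∈ symbPow k q m 1 := by
    rw [symbPow, pow_one]
    exact Ideal.le_comap_map hg
  simpa using lower q m hq hm hco 1 g hg0 hg'

end S18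

/-- The Waldschmidt constant of `𝔭` equals its initial degree:
`γ(𝔭) = lim_n α(𝔭⁽ⁿ⁾)/n = 2 = α(𝔭)`; in fact `α(𝔭⁽²ⁿ⁾) = 4n` and `α(𝔭⁽²ⁿ⁺¹⁾) = 4n+2`
for all `n ≥ 0`. -/
theorem statement18 (k : Type*) [Field k] (q m : ℕ) (hq : 1 ≤ q) (hm : 1 ≤ m)
    (hco : Nat.Coprime (2*q+1) m) :
    alphaDeg (curveIdeal k q m) = 2 ∧
    (∀ n : ℕ, alphaDeg (symbPow k q m (2*n)) = 4*n) ∧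
    (∀ n : ℕ, alphaDeg (symbPow k q m (2*n+1)) = 4*n+2) ∧
    Filter.Tendsto (fun n : ℕ => (alphaDeg (symbPow k q m n) : ℝ) / (n : ℝ))
      Filter.atTop (nhds 2) := by
  refine ⟨S18.alpha_p q m hq hm hco, fun n => ?_, fun n => ?_, ?_⟩
  · rw [S18.alpha q m hq hm hco]; ring
  · rw [S18.alpha q m hq hm hco]; ring
  · refine tendsto_const_nhds.congr' ?_
    filter_upwards [Filter.eventually_gt_atTop 0] with n hn
    rw [S18.alpha q m hq hm hco]
    have : (n : ℝ) ≠ 0 := by positivity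
    push_cast
    field_simp
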